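/- For all indices i, k with 1 ≤ i, k ≤ L−1 and every (t,α) ∈ ℝ × ℝ^{L−1}, one has ∂Γ^k_{00}/∂x_i − ∂Γ^k_{i0}/∂x_0 = ( p_i'(t) p_k(t) [ −B(t) C(t) N(t) − C(t) A(t,α)² + 2 B(t)² P(t) ] − p_i'(t) p_k'(t) B(t) (N(t) B(t) + A(t,α)²) ) / (N(t) B(t) + A(t,α)²)², where C(t) = Σ_{m=1}^{L−1} p_m'(t) p_m''(t) and P(t) = Σ_{m=1}^{L−1} p_m(t) p_m'(t). -/

import Mathlib

/-!
Formalization of results from "A geometric approach to equilibrium selection":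
the metric, Christoffel symbols and curvature of the equilibrium manifold of a
two-consumer exchange economy with `L` goods, parametrized by
`Φ(t,α) = (p_1(t),…,p_{L−1}(t), α_1,…,α_{L−1}, w(t) − Σ_m p_m(t) α_m)`.

Indices run over `Fin L`, where the index `0` corresponds to the coordinate
`x_0 = t` and an index `i ≠ 0` corresponds to the coordinate `x_i = α_i`
(the component `α 0` of `α : Fin L → ℝ` is never used, so `α` is just a copy
of `ℝ^{L−1}` together with an irrelevant extra coordinate).
-/

open Matrix BigOperators

noncomputable section

namespace EqSelection

variable {L : ℕ}

/-- `A(t,α) = w'(t) − Σ_{m=1}^{L−1} p_m'(t) α_m`. -/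
def eqA [NeZero L] (p : Fin L → ℝ → ℝ) (w : ℝ → ℝ) (t : ℝ) (α : Fin L → ℝ) : ℝ :=
  deriv w t - ∑ m ∈ Finset.univ \ {0}, deriv (p m) t * α m

/-- `A'(t,α) = w''(t) − Σ_{m=1}^{L−1} p_m''(t) α_m`. -/
def eqA' [NeZero L] (p : Fin L → ℝ → ℝ) (w : ℝ → ℝ) (t : ℝ) (α : Fin L → ℝ) : ℝ :=
  deriv (deriv w) t - ∑ m ∈ Finset.univ \ {0}, deriv (deriv (p m)) t * α m

/-- `B(t) = Σ_{m=1}^{L−1} (p_m'(t))²`. -/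
def eqB [NeZero L] (p : Fin L → ℝ → ℝ) (t : ℝ) : ℝ :=
  ∑ m ∈ Finset.univ \ {0}, (deriv (p m) t) ^ 2

/-- `N(t) = 1 + Σ_{m=1}^{L−1} (p_m(t))²`. -/
def eqN [NeZero L] (p : Fin L → ℝ → ℝ) (t : ℝ) : ℝ :=
  1 + ∑ m ∈ Finset.univ \ {0}, (p m t) ^ 2

/-- `C(t) = Σ_{m=1}^{L−1} p_m'(t) p_m''(t)`. -/
def eqC [NeZero L] (p : Fin L → ℝ → ℝ) (t : ℝ) : ℝ :=
  ∑ m ∈ Finset.univ \ {0}, deriv (p m) t * deriv (deriv (p m)) t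

/-- `P(t) = Σ_{m=1}^{L−1} p_m(t) p_m'(t)`. -/
def eqP [NeZero L] (p : Fin L → ℝ → ℝ) (t : ℝ) : ℝ :=
  ∑ m ∈ Finset.univ \ {0}, p m t * deriv (p m) t

/-- The induced metric matrix `g(t,α)`: `g_{00} = B + A²`, `g_{0i} = g_{i0} = −p_i A`,
`g_{ij} = p_i p_j + δ_{ij}` for `i, j ≠ 0`. -/
def gMat [NeZero L] (p : Fin L → ℝ → ℝ) (w : ℝ → ℝ) (t : ℝ) (α : Fin L → ℝ) :
    Matrix (Fin L) (Fin L) ℝ :=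
  Matrix.of fun i j =>
    if i = 0 then
      if j = 0 then eqB p t + (eqA p w t α) ^ 2 else -(p j t) * eqA p w t α
    else
      if j = 0 then -(p i t) * eqA p w t α
      else p i t * p j t + (if i = j then 1 else 0)

/-- Partial derivative with respect to the coordinate `x_k`, where `x_0 = t`
and `x_i = α_i` for `i ≠ 0`. -/
def pder [NeZero L] (k : Fin L) (f : ℝ → (Fin L → ℝ) → ℝ) (t : ℝ) (α : Fin L → ℝ) : ℝ :=
  if k = 0 then deriv (fun s => f s α) t
  else deriv (fun s => f t (Function.update α k s)) (α k)

/-- Christoffel symbol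
`Γ^k_{ij} = (1/2) Σ_{h=0}^{L−1} g^{hk} (∂g_{jh}/∂x_i + ∂g_{hi}/∂x_j − ∂g_{ij}/∂x_h)`,
written `christoffel p w i j k`.  (Here `g^{hk}` denotes the entries of the inverse
matrix of `g`, i.e. of `(gMat p w t α)⁻¹`.) -/
def christoffel [NeZero L] (p : Fin L → ℝ → ℝ) (w : ℝ → ℝ) (i j k : Fin L)
    (t : ℝ) (α : Fin L → ℝ) : ℝ :=
  (1 / 2) * ∑ h : Fin L,
    (gMat p w t α)⁻¹ h k *
      (pder i (fun t' α' => gMat p w t' α' j h) t α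
        + pder j (fun t' α' => gMat p w t' α' h i) t α
        - pder h (fun t' α' => gMat p w t' α' i j) t α)

/-- Curvature coefficient
`R^s_{ijk} = Σ_{m} Γ^m_{ik} Γ^s_{jm} − Σ_{m} Γ^m_{jk} Γ^s_{im} + ∂Γ^s_{ik}/∂x_j − ∂Γ^s_{jk}/∂x_i`,
written `curvR p w i j k s`. -/
def curvR [NeZero L] (p : Fin L → ℝ → ℝ) (w : ℝ → ℝ) (i j k s : Fin L)
    (t : ℝ) (α : Fin L → ℝ) : ℝ :=
  (∑ m : Fin L, christoffel p w i k m t α * christoffel p w j m s t α)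
    - (∑ m : Fin L, christoffel p w j k m t α * christoffel p w i m s t α)
    + pder j (christoffel p w i k s) t α - pder i (christoffel p w j k s) t α

/-- The coordinate tangent vectors `Φ_i(t,α) ∈ ℝ^{2L−1}` of the parametrization
`Φ(t,α) = (p_1(t),…,p_{L−1}(t), α_1,…,α_{L−1}, w(t) − Σ_m p_m(t) α_m)`:
`Φ_0 = (p_1',…,p_{L−1}', 0,…,0, A)`, and for `i ≠ 0` the vector `Φ_i` has entry `1`
in position `(L−1)+i` (1-indexed), entry `−p_i` in the last position and `0` elsewhere. -/
def PhiVec [NeZero L] (p : Fin L → ℝ → ℝ) (w : ℝ → ℝ) (i : Fin L)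
    (t : ℝ) (α : Fin L → ℝ) : Fin (2 * L - 1) → ℝ :=
  fun j =>
    if i = 0 then
      if h : (j : ℕ) < L - 1 then deriv (p ⟨(j : ℕ) + 1, by omega⟩) t
      else if (j : ℕ) = 2 * L - 2 then eqA p w t α else 0
    else
      if (j : ℕ) + 1 = (L - 1) + (i : ℕ) then 1
      else if (j : ℕ) = 2 * L - 2 then -(p i t) else 0

/-- The matrix `M(t,α)` of Statement 2: `M_{00} = N`, `M_{0i} = M_{i0} = p_i A`,
`M_{ii} = (N − p_i²) B + A²`, `M_{ij} = −p_i p_j B` for `i ≠ j`, `i, j ≠ 0`. -/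
def invNumer [NeZero L] (p : Fin L → ℝ → ℝ) (w : ℝ → ℝ) (t : ℝ) (α : Fin L → ℝ) :
    Matrix (Fin L) (Fin L) ℝ :=
  Matrix.of fun i j =>
    if i = 0 then
      if j = 0 then eqN p t else p j t * eqA p w t α
    else
      if j = 0 then p i t * eqA p w t α
      else if i = j then (eqN p t - (p i t) ^ 2) * eqB p t + (eqA p w t α) ^ 2
      else -(p i t * p j t * eqB p t)

section Derivatives

variable [NeZero L] {p : Fin L → ℝ → ℝ} {w : ℝ → ℝ}

theorem eqA_update (p : Fin L → ℝ → ℝ) (w : ℝ → ℝ) {k : Fin L} (hk : k ≠ 0) (t s : ℝ)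
    (α : Fin L → ℝ) :
    eqA p w t (Function.update α k s) = eqA p w t α - deriv (p k) t * (s - α k) := by
  have hmem : k ∈ Finset.univ \ {(0 : Fin L)} := by simp [hk]
  have hsum : ∑ m ∈ (Finset.univ \ {(0 : Fin L)}).erase k,
        deriv (p m) t * Function.update α k s m
      = ∑ m ∈ (Finset.univ \ {(0 : Fin L)}).erase k, deriv (p m) t * α m :=
    Finset.sum_congr rfl fun m hm => by
      rw [Function.update_of_ne (Finset.ne_of_mem_erase hm)]
  unfold eqA
  rw [← Finset.add_sum_erase _ _ hmem, ← Finset.add_sum_erase _ _ hmem, hsum,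
    Function.update_self]
  ring

theorem eqA'_update (p : Fin L → ℝ → ℝ) (w : ℝ → ℝ) {k : Fin L} (hk : k ≠ 0) (t s : ℝ)
    (α : Fin L → ℝ) :
    eqA' p w t (Function.update α k s)
      = eqA' p w t α - deriv (deriv (p k)) t * (s - α k) := by
  have hmem : k ∈ Finset.univ \ {(0 : Fin L)} := by simp [hk]
  have hsum : ∑ m ∈ (Finset.univ \ {(0 : Fin L)}).erase k,
        deriv (deriv (p m)) t * Function.update α k s m
      = ∑ m ∈ (Finset.univ \ {(0 : Fin L)}).erase k, deriv (deriv (p m)) t * α m :=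
    Finset.sum_congr rfl fun m hm => by
      rw [Function.update_of_ne (Finset.ne_of_mem_erase hm)]
  unfold eqA'
  rw [← Finset.add_sum_erase _ _ hmem, ← Finset.add_sum_erase _ _ hmem, hsum,
    Function.update_self]
  ring

theorem hasDerivAt_eqA_update {k : Fin L} (hk : k ≠ 0) (t : ℝ) (α : Fin L → ℝ) :
    HasDerivAt (fun s => eqA p w t (Function.update α k s)) (-deriv (p k) t) (α k) := by
  simp only [eqA_update p w hk]
  simpa using (((hasDerivAt_id (α k)).sub_const (α k)).const_mul (deriv (p k) t)).const_sub
    (eqA p w t α)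

theorem hasDerivAt_eqA'_update {k : Fin L} (hk : k ≠ 0) (t : ℝ) (α : Fin L → ℝ) :
    HasDerivAt (fun s => eqA' p w t (Function.update α k s)) (-deriv (deriv (p k)) t)
      (α k) := by
  simp only [eqA'_update p w hk]
  simpa using (((hasDerivAt_id (α k)).sub_const (α k)).const_mul
    (deriv (deriv (p k)) t)).const_sub (eqA' p w t α)

theorem hasDerivAt_of_smooth {f : ℝ → ℝ} (hf : ContDiff ℝ (⊤ : ℕ∞) f) (t : ℝ) :
    HasDerivAt f (deriv f t) t :=
  (hf.differentiable (by simp) t).hasDerivAt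

theorem hasDerivAt_deriv_of_smooth {f : ℝ → ℝ} (hf : ContDiff ℝ (⊤ : ℕ∞) f) (t : ℝ) :
    HasDerivAt (deriv f) (deriv (deriv f) t) t :=
  hasDerivAt_of_smooth (contDiff_infty_iff_deriv.1 hf).2 t

theorem hasDerivAt_eqA (hp : ∀ i, ContDiff ℝ (⊤ : ℕ∞) (p i)) (hw : ContDiff ℝ (⊤ : ℕ∞) w)
    (t : ℝ) (α : Fin L → ℝ) :
    HasDerivAt (fun s => eqA p w s α) (eqA' p w t α) t :=
  (hasDerivAt_deriv_of_smooth hw t).sub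
    (HasDerivAt.fun_sum fun m _ => (hasDerivAt_deriv_of_smooth (hp m) t).mul_const (α m))

theorem hasDerivAt_eqB (hp : ∀ i, ContDiff ℝ (⊤ : ℕ∞) (p i)) (t : ℝ) :
    HasDerivAt (fun s => eqB p s) (2 * eqC p t) t := by
  have h := HasDerivAt.fun_sum (u := Finset.univ \ {(0 : Fin L)}) fun m _ =>
    (hasDerivAt_deriv_of_smooth (hp m) t).fun_pow 2
  refine h.congr_deriv ?_
  rw [eqC, Finset.mul_sum]
  exact Finset.sum_congr rfl fun m _ => by push_cast; ring

theorem hasDerivAt_eqN (hp : ∀ i, ContDiff ℝ (⊤ : ℕ∞) (p i)) (t : ℝ) :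
    HasDerivAt (fun s => eqN p s) (2 * eqP p t) t := by
  have h := (HasDerivAt.fun_sum (u := Finset.univ \ {(0 : Fin L)}) fun m _ =>
    (hasDerivAt_of_smooth (hp m) t).fun_pow 2).const_add 1
  refine h.congr_deriv ?_
  rw [eqP, Finset.mul_sum]
  exact Finset.sum_congr rfl fun m _ => by push_cast; ring

end Derivatives

section Inverse

variable [NeZero L] {p : Fin L → ℝ → ℝ} {w : ℝ → ℝ}

theorem sum_eq_zero_term_add (f : Fin L → ℝ) :
    ∑ h, f h = f 0 + ∑ h ∈ Finset.univ \ {0}, f h := by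
  rw [← Finset.erase_eq, Finset.add_sum_erase _ _ (Finset.mem_univ 0)]

theorem det_pos (hreg : ∀ t : ℝ, 0 < eqB p t ∨ deriv w t ≠ 0) (t : ℝ) (α : Fin L → ℝ) :
    0 < eqN p t * eqB p t + eqA p w t α ^ 2 := by
  have hN : 0 < eqN p t :=
    add_pos_of_pos_of_nonneg one_pos (Finset.sum_nonneg fun m _ => sq_nonneg _)
  have hB : 0 ≤ eqB p t := Finset.sum_nonneg fun m _ => sq_nonneg _
  rcases hB.lt_or_eq with h | h
  · positivity
  · have hd : ∀ m ∈ Finset.univ \ {(0 : Fin L)}, deriv (p m) t ^ 2 = 0 :=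
      (Finset.sum_eq_zero_iff_of_nonneg fun m _ => sq_nonneg _).1 h.symm
    have hA : eqA p w t α = deriv w t := by
      rw [eqA, Finset.sum_eq_zero fun m hm => by rw [pow_eq_zero_iff two_ne_zero |>.1 (hd m hm),
        zero_mul], sub_zero]
    have hw' : deriv w t ≠ 0 := (hreg t).resolve_left (by rw [← h]; exact lt_irrefl 0)
    rw [hA]
    positivity

theorem invNumer_of_ne_zero {h k : Fin L} (hh : h ≠ 0) (hk : k ≠ 0) (t : ℝ) (α : Fin L → ℝ) :
    invNumer p w t α h k
      = (if h = k then eqN p t * eqB p t + eqA p w t α ^ 2 else 0)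
        - p h t * p k t * eqB p t := by
  by_cases e : h = k
  · subst e
    simp [invNumer, hh]
    ring
  · simp [invNumer, hh, hk, e]

theorem sum_mul_invNumer {k : Fin L} (hk : k ≠ 0) (t : ℝ) (α : Fin L → ℝ) :
    ∑ h ∈ Finset.univ \ {0}, p h t * invNumer p w t α h k
      = p k t * (eqB p t + eqA p w t α ^ 2) := by
  have hmem : k ∈ Finset.univ \ {(0 : Fin L)} := by simp [hk]
  have hsum : ∑ h ∈ Finset.univ \ {0}, p h t * invNumer p w t α h k
      = ∑ h ∈ Finset.univ \ {0},
        ((if h = k then p h t * (eqN p t * eqB p t + eqA p w t α ^ 2) else 0)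
          - p h t ^ 2 * (p k t * eqB p t)) :=
    Finset.sum_congr rfl fun h hh => by
      rw [invNumer_of_ne_zero (by simpa using hh) hk]
      split_ifs <;> ring
  rw [hsum, Finset.sum_sub_distrib, Finset.sum_ite_eq' _ k, if_pos hmem, ← Finset.sum_mul,
    eqN]
  ring

theorem gMat_mul_invNumer (p : Fin L → ℝ → ℝ) (w : ℝ → ℝ) (t : ℝ) (α : Fin L → ℝ) :
    gMat p w t α * invNumer p w t α = (eqN p t * eqB p t + eqA p w t α ^ 2) • 1 := by
  have hcol : ∑ m ∈ Finset.univ \ {0}, p m t * invNumer p w t α m 0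
      = (eqN p t - 1) * eqA p w t α := by
    rw [eqN, add_sub_cancel_left, Finset.sum_mul]
    refine Finset.sum_congr rfl fun m hm => ?_
    have hm0 : m ≠ 0 := by simpa using hm
    simp [invNumer, hm0]
    ring
  ext i k
  rw [Matrix.mul_apply, sum_eq_zero_term_add]
  by_cases hi : i = 0
  · have hrow : ∑ m ∈ Finset.univ \ {0}, gMat p w t α i m * invNumer p w t α m k
        = -eqA p w t α * ∑ m ∈ Finset.univ \ {0}, p m t * invNumer p w t α m k := by
      rw [Finset.mul_sum]
      refine Finset.sum_congr rfl fun m hm => ?_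
      have hm0 : m ≠ 0 := by simpa using hm
      simp [gMat, hi, hm0]
      ring
    rw [hrow]
    subst hi
    by_cases hk : k = 0
    · subst hk
      rw [hcol]
      simp [gMat, invNumer]
      ring
    · rw [sum_mul_invNumer hk]
      simp [gMat, invNumer, hk, Ne.symm hk]
      ring
  · have himem : i ∈ Finset.univ \ {(0 : Fin L)} := by simp [hi]
    have hrow : ∑ m ∈ Finset.univ \ {0}, gMat p w t α i m * invNumer p w t α m k
        = p i t * ∑ m ∈ Finset.univ \ {0}, p m t * invNumer p w t α m k
          + invNumer p w t α i k := by
      have hsum : ∑ m ∈ Finset.univ \ {0}, gMat p w t α i m * invNumer p w t α m k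
          = ∑ m ∈ Finset.univ \ {0}, (p i t * (p m t * invNumer p w t α m k)
            + if i = m then invNumer p w t α m k else 0) := by
        refine Finset.sum_congr rfl fun m hm => ?_
        have hm0 : m ≠ 0 := by simpa using hm
        simp only [gMat, Matrix.of_apply, hi, hm0, if_false]
        split_ifs <;> ring
      rw [hsum, Finset.sum_add_distrib, ← Finset.mul_sum, Finset.sum_ite_eq, if_pos himem]
    rw [hrow]
    by_cases hk : k = 0
    · subst hk
      rw [hcol]
      simp [gMat, invNumer, hi]
      ring
    · rw [sum_mul_invNumer hk, invNumer_of_ne_zero hi hk]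
      simp [gMat, invNumer, hi, hk, Matrix.one_apply]
      ring

theorem gMat_inv_apply (hreg : ∀ t : ℝ, 0 < eqB p t ∨ deriv w t ≠ 0) (t : ℝ)
    (α : Fin L → ℝ) (h k : Fin L) :
    (gMat p w t α)⁻¹ h k
      = invNumer p w t α h k / (eqN p t * eqB p t + eqA p w t α ^ 2) := by
  have hinv : (gMat p w t α)⁻¹
      = (eqN p t * eqB p t + eqA p w t α ^ 2)⁻¹ • invNumer p w t α := by
    refine Matrix.inv_eq_right_inv ?_
    rw [Matrix.mul_smul, gMat_mul_invNumer, smul_smul, inv_mul_cancel₀ (det_pos hreg t α).ne',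
      one_smul]
  rw [hinv, Matrix.smul_apply, smul_eq_mul, div_eq_inv_mul]

end Inverse

section Christoffel

variable [NeZero L] {p : Fin L → ℝ → ℝ} {w : ℝ → ℝ}

theorem pder_zero_eq {f : ℝ → (Fin L → ℝ) → ℝ} {t : ℝ} {α : Fin L → ℝ} {d : ℝ}
    (hf : HasDerivAt (fun s => f s α) d t) : pder 0 f t α = d := by
  rw [pder, if_pos rfl, hf.deriv]

theorem pder_of_ne_zero_eq {f : ℝ → (Fin L → ℝ) → ℝ} {k : Fin L} (hk : k ≠ 0) {t : ℝ}
    {α : Fin L → ℝ} {d : ℝ}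
    (hf : HasDerivAt (fun s => f t (Function.update α k s)) d (α k)) : pder k f t α = d := by
  rw [pder, if_neg hk, hf.deriv]

theorem gMat_symm (i j : Fin L) (t : ℝ) (α : Fin L → ℝ) :
    gMat p w t α i j = gMat p w t α j i := by
  simp only [gMat, Matrix.of_apply, eq_comm (a := i) (b := j)]
  split_ifs <;> ring

theorem pder_zero_gMat_zero_zero (hp : ∀ i, ContDiff ℝ (⊤ : ℕ∞) (p i))
    (hw : ContDiff ℝ (⊤ : ℕ∞) w) (t : ℝ) (α : Fin L → ℝ) :
    pder 0 (fun t' α' => gMat p w t' α' 0 0) t α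
      = 2 * eqC p t + 2 * eqA p w t α * eqA' p w t α := by
  refine pder_zero_eq ?_
  simp only [gMat, Matrix.of_apply, if_true]
  refine ((hasDerivAt_eqB hp t).add ((hasDerivAt_eqA hp hw t α).fun_pow 2)).congr_deriv ?_
  push_cast
  ring

theorem pder_zero_gMat_zero (hp : ∀ i, ContDiff ℝ (⊤ : ℕ∞) (p i))
    (hw : ContDiff ℝ (⊤ : ℕ∞) w) {h : Fin L} (hh : h ≠ 0) (t : ℝ) (α : Fin L → ℝ) :
    pder 0 (fun t' α' => gMat p w t' α' 0 h) t α
      = -deriv (p h) t * eqA p w t α - p h t * eqA' p w t α := by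
  refine pder_zero_eq ?_
  simp only [gMat, Matrix.of_apply, if_true, hh, if_false]
  refine ((hasDerivAt_of_smooth (hp h) t).fun_neg.mul
    (hasDerivAt_eqA hp hw t α)).congr_deriv ?_
  ring

theorem pder_zero_gMat_of_ne_zero (hp : ∀ i, ContDiff ℝ (⊤ : ℕ∞) (p i)) {h i : Fin L}
    (hh : h ≠ 0) (hi : i ≠ 0) (t : ℝ) (α : Fin L → ℝ) :
    pder 0 (fun t' α' => gMat p w t' α' h i) t α
      = deriv (p h) t * p i t + p h t * deriv (p i) t := by
  refine pder_zero_eq ?_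
  simp only [gMat, Matrix.of_apply, hi, hh, if_false]
  exact ((hasDerivAt_of_smooth (hp h) t).mul (hasDerivAt_of_smooth (hp i) t)).add_const _

theorem pder_gMat_zero_zero {h : Fin L} (hh : h ≠ 0) (t : ℝ) (α : Fin L → ℝ) :
    pder h (fun t' α' => gMat p w t' α' 0 0) t α = -2 * eqA p w t α * deriv (p h) t := by
  refine pder_of_ne_zero_eq hh ?_
  simp only [gMat, Matrix.of_apply, if_true]
  refine (((hasDerivAt_eqA_update hh t α).fun_pow 2).const_add (eqB p t)).congr_deriv ?_
  rw [Function.update_eq_self]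
  push_cast
  ring

theorem pder_gMat_zero {h i : Fin L} (hh : h ≠ 0) (hi : i ≠ 0) (t : ℝ) (α : Fin L → ℝ) :
    pder h (fun t' α' => gMat p w t' α' 0 i) t α = p i t * deriv (p h) t := by
  refine pder_of_ne_zero_eq hh ?_
  simp only [gMat, Matrix.of_apply, if_true, hi, if_false]
  exact ((hasDerivAt_eqA_update hh t α).const_mul (-p i t)).congr_deriv (by ring)

theorem christoffel_zero_zero (hp : ∀ i, ContDiff ℝ (⊤ : ℕ∞) (p i))
    (hw : ContDiff ℝ (⊤ : ℕ∞) w) (hreg : ∀ t : ℝ, 0 < eqB p t ∨ deriv w t ≠ 0)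
    {k : Fin L} (hk : k ≠ 0) (t : ℝ) (α : Fin L → ℝ) :
    christoffel p w 0 0 k t α
      = p k t * (eqA p w t α * eqC p t - eqA' p w t α * eqB p t)
        / (eqN p t * eqB p t + eqA p w t α ^ 2) := by
  have hsum : ∑ h ∈ Finset.univ \ {0}, (gMat p w t α)⁻¹ h k *
      (pder 0 (fun t' α' => gMat p w t' α' 0 h) t α
        + pder 0 (fun t' α' => gMat p w t' α' h 0) t α
        - pder h (fun t' α' => gMat p w t' α' 0 0) t α)
      = (∑ h ∈ Finset.univ \ {0}, p h t * invNumer p w t α h k)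
        * (-2 * eqA' p w t α / (eqN p t * eqB p t + eqA p w t α ^ 2)) := by
    rw [Finset.sum_mul]
    refine Finset.sum_congr rfl fun h hh => ?_
    have hh0 : h ≠ 0 := by simpa using hh
    simp only [gMat_symm h 0]
    rw [gMat_inv_apply hreg, pder_zero_gMat_zero hp hw hh0, pder_gMat_zero_zero hh0]
    ring
  have hM : invNumer p w t α 0 k = p k t * eqA p w t α := by simp [invNumer, hk]
  rw [christoffel, sum_eq_zero_term_add, hsum, sum_mul_invNumer hk, gMat_inv_apply hreg, hM,
    pder_zero_gMat_zero_zero hp hw]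
  ring

theorem christoffel_zero (hp : ∀ i, ContDiff ℝ (⊤ : ℕ∞) (p i))
    (hreg : ∀ t : ℝ, 0 < eqB p t ∨ deriv w t ≠ 0)
    {i k : Fin L} (hi : i ≠ 0) (hk : k ≠ 0) (t : ℝ) (α : Fin L → ℝ) :
    christoffel p w i 0 k t α
      = deriv (p i) t * p k t * eqB p t / (eqN p t * eqB p t + eqA p w t α ^ 2) := by
  have hsum : ∑ h ∈ Finset.univ \ {0}, (gMat p w t α)⁻¹ h k *
      (pder i (fun t' α' => gMat p w t' α' 0 h) t α
        + pder 0 (fun t' α' => gMat p w t' α' h i) t α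
        - pder h (fun t' α' => gMat p w t' α' i 0) t α)
      = (∑ h ∈ Finset.univ \ {0}, p h t * invNumer p w t α h k)
        * (2 * deriv (p i) t / (eqN p t * eqB p t + eqA p w t α ^ 2)) := by
    rw [Finset.sum_mul]
    refine Finset.sum_congr rfl fun h hh => ?_
    have hh0 : h ≠ 0 := by simpa using hh
    simp only [gMat_symm i 0]
    rw [gMat_inv_apply hreg, pder_gMat_zero hi hh0, pder_zero_gMat_of_ne_zero hp hh0 hi,
      pder_gMat_zero hh0 hi]
    ring
  have hM : invNumer p w t α 0 k = p k t * eqA p w t α := by simp [invNumer, hk]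
  rw [christoffel, sum_eq_zero_term_add, hsum, sum_mul_invNumer hk, gMat_inv_apply hreg, hM,
    pder_gMat_zero_zero hi]
  simp only [gMat_symm i 0]
  ring

end Christoffel

theorem statement_13 (L : ℕ) [NeZero L] (hL : 2 ≤ L)
    (p : Fin L → ℝ → ℝ) (w : ℝ → ℝ)
    (hp : ∀ i, ContDiff ℝ (⊤ : ℕ∞) (p i)) (hw : ContDiff ℝ (⊤ : ℕ∞) w)
    (hreg : ∀ t : ℝ, 0 < eqB p t ∨ deriv w t ≠ 0) :
    ∀ i k : Fin L, i ≠ 0 → k ≠ 0 →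
      ∀ (t : ℝ) (α : Fin L → ℝ),
        pder i (christoffel p w 0 0 k) t α - pder 0 (christoffel p w i 0 k) t α
          = (deriv (p i) t * p k t
                * (-(eqB p t) * eqC p t * eqN p t - eqC p t * (eqA p w t α) ^ 2
                    + 2 * (eqB p t) ^ 2 * eqP p t)
              - deriv (p i) t * deriv (p k) t * eqB p t * (eqN p t * eqB p t + (eqA p w t α) ^ 2))
            / (eqN p t * eqB p t + (eqA p w t α) ^ 2) ^ 2 := by
  intro i k hi hk t α
  have hD := (det_pos hreg t α).ne'
  have h00 : pder i (christoffel p w 0 0 k) t α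
      = ((p k t * (-deriv (p i) t * eqC p t + deriv (deriv (p i)) t * eqB p t))
          * (eqN p t * eqB p t + eqA p w t α ^ 2)
        + p k t * (eqA p w t α * eqC p t - eqA' p w t α * eqB p t)
          * (2 * eqA p w t α * deriv (p i) t))
        / (eqN p t * eqB p t + eqA p w t α ^ 2) ^ 2 := by
    refine pder_of_ne_zero_eq hi ?_
    simp only [christoffel_zero_zero hp hw hreg hk]
    have hA := hasDerivAt_eqA_update (p := p) (w := w) hi t α
    have hA' := hasDerivAt_eqA'_update (p := p) (w := w) hi t α
    refine ((((hA.mul_const (eqC p t)).fun_sub (hA'.mul_const (eqB p t))).const_mul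
      (p k t)).fun_div ((hA.fun_pow 2).const_add (eqN p t * eqB p t))
        (by rwa [Function.update_eq_self])).congr_deriv ?_
    rw [Function.update_eq_self]
    push_cast
    ring
  have hi0 : pder 0 (christoffel p w i 0 k) t α
      = ((deriv (deriv (p i)) t * p k t * eqB p t + deriv (p i) t * deriv (p k) t * eqB p t
            + 2 * deriv (p i) t * p k t * eqC p t)
          * (eqN p t * eqB p t + eqA p w t α ^ 2)
        - deriv (p i) t * p k t * eqB p t
          * (2 * eqP p t * eqB p t + 2 * eqN p t * eqC p t
            + 2 * eqA p w t α * eqA' p w t α))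
        / (eqN p t * eqB p t + eqA p w t α ^ 2) ^ 2 := by
    refine pder_zero_eq ?_
    simp only [christoffel_zero hp hreg hi hk]
    have hB := hasDerivAt_eqB hp t
    refine ((((hasDerivAt_deriv_of_smooth (hp i) t).fun_mul
      (hasDerivAt_of_smooth (hp k) t)).fun_mul hB).fun_div
        (((hasDerivAt_eqN hp t).fun_mul hB).fun_add ((hasDerivAt_eqA hp hw t α).fun_pow 2))
          hD).congr_deriv ?_
    push_cast
    ring
  rw [h00, hi0, ← sub_div]
  congr 1
  ring

end EqSelection
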